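/- Let V be a finite-dimensional vector space over the field with 5 elements equipped with a non-degenerate symmetric bilinear form Q. If x, y ∈ V are nonzero vectors with Q(x,x) = Q(y,y), then there exists A in the special orthogonal group SO(Q) with A x = y. -/

import Mathlib

lemma aux_refl [Fact (Nat.Prime 5)] {V : Type*} [AddCommGroup V] [Module (ZMod 5) V] [FiniteDimensional (ZMod 5) V]
    (Q : V →ₗ[ZMod 5] V →ₗ[ZMod 5] ZMod 5)
    (hsymm : ∀ x y : V, Q x y = Q y x) (a : V) (ha : Q a a ≠ 0) :
    ∃ s : V ≃ₗ[ZMod 5] V, (∀ u v : V, Q (s u) (s v) = Q u v) ∧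
      LinearMap.det (s : V →ₗ[ZMod 5] V) = -1 ∧
      ∀ u, s u = u - (2 * Q a u / Q a a) • a := by
  let f : Module.Dual (ZMod 5) V := (2 / Q a a) • Q a
  have hf : f a = 2 := by
    simp only [f, LinearMap.smul_apply, smul_eq_mul]; field_simp
  have hfu : ∀ u, f u = 2 * Q a u / Q a a := by
    intro u; simp only [f, LinearMap.smul_apply, smul_eq_mul]; ring
  have happ : ∀ u, Module.reflection hf u = u - (2 * Q a u / Q a a) • a := by
    intro u; rw [Module.reflection_apply, hfu]
  refine ⟨Module.reflection hf, ?_, ?_, happ⟩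
  · intro u v
    rw [happ, happ]
    simp only [map_sub, map_smul, LinearMap.sub_apply, LinearMap.smul_apply, smul_eq_mul]
    rw [hsymm u a]
    field_simp
    ring
  · have : (Module.reflection hf : V →ₗ[ZMod 5] V) = LinearMap.transvection (-f) a := by
      ext u
      simp [Module.reflection_apply, LinearMap.transvection.apply, sub_eq_add_neg]
    rw [this, LinearMap.transvection.det, LinearMap.neg_apply, hf]; ring

lemma aux_swap [Fact (Nat.Prime 5)] {V : Type*} [AddCommGroup V] [Module (ZMod 5) V] [FiniteDimensional (ZMod 5) V]
    (Q : V →ₗ[ZMod 5] V →ₗ[ZMod 5] ZMod 5)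
    (hsymm : ∀ x y : V, Q x y = Q y x) (x y : V) (hQ : Q x x = Q y y)
    (ha : Q (x - y) (x - y) ≠ 0) :
    ∃ s : V ≃ₗ[ZMod 5] V, (∀ u v : V, Q (s u) (s v) = Q u v) ∧
      LinearMap.det (s : V →ₗ[ZMod 5] V) = -1 ∧ s x = y := by
  obtain ⟨s, h1, h2, h3⟩ := aux_refl Q hsymm _ ha
  refine ⟨s, h1, h2, ?_⟩
  have : 2 * Q (x - y) x / Q (x - y) (x - y) = 1 := by
    rw [div_eq_one_iff_eq ha]
    simp only [map_sub, LinearMap.sub_apply]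
    rw [hsymm y x, ← hQ]; ring
  rw [h3, this]; simp

lemma aux_iso [Fact (Nat.Prime 5)] {V : Type*} [AddCommGroup V] [Module (ZMod 5) V] [FiniteDimensional (ZMod 5) V]
    (hdim : Module.finrank (ZMod 5) V = 3)
    (Q : V →ₗ[ZMod 5] V →ₗ[ZMod 5] ZMod 5)
    (hsymm : ∀ x y : V, Q x y = Q y x)
    (hnd : ∀ x : V, (∀ y : V, Q x y = 0) → x = 0)
    (W : Submodule (ZMod 5) V) (hW : ∀ u ∈ W, ∀ v ∈ W, Q u v = 0) :
    Module.finrank (ZMod 5) W ≤ 1 := by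
  have h := LinearMap.BilinForm.finrank_add_finrank_orthogonal' (B := Q) W
  have hk : LinearMap.ker Q = ⊥ := by
    rw [LinearMap.ker_eq_bot']
    intro m hm
    exact hnd m (fun y => by rw [hm]; rfl)
  rw [hk, inf_bot_eq, finrank_bot, hdim] at h
  have hle : W ≤ LinearMap.BilinForm.orthogonal Q W := by
    intro u hu v hv
    exact hW v hv u hu
  have := Submodule.finrank_mono hle
  omega


/-- Witt-type transitivity: over the field with 5 elements, in a (3-dimensional)
space with a non-degenerate symmetric bilinear form `Q`, any two nonzero vectors
with the same value `Q(x,x) = Q(y,y)` are related by an element of `SO(Q)`. -/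
theorem stmt17 {V : Type*} [AddCommGroup V] [Module (ZMod 5) V]
    (hdim : Module.finrank (ZMod 5) V = 3)
    (Q : V →ₗ[ZMod 5] V →ₗ[ZMod 5] ZMod 5)
    (hsymm : ∀ x y : V, Q x y = Q y x)
    (hnd : ∀ x : V, (∀ y : V, Q x y = 0) → x = 0)
    (x y : V) (hx : x ≠ 0) (hy : y ≠ 0) (hQ : Q x x = Q y y) :
    ∃ A : V ≃ₗ[ZMod 5] V,
      (∀ u v : V, Q (A u) (A v) = Q u v) ∧
      LinearMap.det (A : V →ₗ[ZMod 5] V) = 1 ∧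
      A x = y := by
  have two : (2 : ZMod 5) ≠ 0 := by decide
  have : Fact (Nat.Prime 5) := ⟨by norm_num⟩
  have : FiniteDimensional (ZMod 5) V := FiniteDimensional.of_finrank_pos (by omega)
  have key : ∀ s t : V ≃ₗ[ZMod 5] V, (∀ u v : V, Q (s u) (s v) = Q u v) →
      (∀ u v : V, Q (t u) (t v) = Q u v) →
      LinearMap.det (s : V →ₗ[ZMod 5] V) = -1 → LinearMap.det (t : V →ₗ[ZMod 5] V) = -1 →
      t (s x) = y → ∃ A : V ≃ₗ[ZMod 5] V,
      (∀ u v : V, Q (A u) (A v) = Q u v) ∧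
      LinearMap.det (A : V →ₗ[ZMod 5] V) = 1 ∧ A x = y := by
    intro s t hs ht ds dt h
    refine ⟨s.trans t, ?_, ?_, h⟩
    · intro u v
      rw [LinearEquiv.trans_apply, LinearEquiv.trans_apply, ht, hs]
    · rw [LinearEquiv.coe_trans, LinearMap.det_comp, ds, dt]; ring
  by_cases h1 : Q (x - -y) (x - -y) = 0
  swap
  · obtain ⟨s, hs, ds, hsx⟩ := aux_swap Q hsymm x (-y) (by simpa using hQ) h1
    refine key s (LinearEquiv.neg (ZMod 5)) hs ?_ ds ?_ ?_
    · intro u v; simp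
    · have : ((LinearEquiv.neg (ZMod 5) : V ≃ₗ[ZMod 5] V) : V →ₗ[ZMod 5] V)
          = (-1 : ZMod 5) • LinearMap.id := by ext u; simp
      rw [this, LinearMap.det_smul, hdim, LinearMap.det_id]; ring
    · simp [hsx]
  by_cases h2 : Q (x - y) (x - y) = 0
  swap
  · obtain ⟨s, hs, ds, hsx⟩ := aux_swap Q hsymm x y hQ h2
    have : ∃ w, Q x w = 0 ∧ Q w w ≠ 0 := by
      by_contra! hc
      have hle := aux_iso hdim Q hsymm hnd (LinearMap.ker (Q x)) (by
        intro u hu v hv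
        rw [LinearMap.mem_ker] at hu hv
        have e := hc (u + v) (by simp [hu, hv])
        simp only [map_add, LinearMap.add_apply] at e
        rw [hc u hu, hc v hv, hsymm v u] at e
        have : 2 * Q u v = 0 := by linear_combination e
        exact (mul_eq_zero.mp this).resolve_left two)
      have e1 := LinearMap.finrank_range_add_finrank_ker (Q x)
      have e2 := Submodule.finrank_le (LinearMap.range (Q x))
      rw [Module.finrank_self] at e2
      omega
    obtain ⟨w, hw, hww⟩ := this
    obtain ⟨t, ht, dt, htx⟩ := aux_refl Q hsymm w hww
    refine key t s ht hs dt ds ?_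
    rw [htx, hsymm w x, hw]
    simpa using hsx
  have e1 : Q x x = 0 := by
    simp only [map_sub, map_neg, LinearMap.sub_apply, LinearMap.neg_apply] at h1 h2
    rw [hsymm y x, ← hQ] at h1 h2
    have : 2 * (2 * Q x x) = 0 := by linear_combination h1 + h2
    simpa [two] using this
  have e2 : Q x y = 0 := by
    simp only [map_sub, map_neg, LinearMap.sub_apply, LinearMap.neg_apply] at h1
    rw [hsymm y x, ← hQ, e1] at h1
    have : 2 * Q x y = 0 := by linear_combination h1
    simpa [two] using this
  have hle := aux_iso hdim Q hsymm hnd (Submodule.span (ZMod 5) {x, y}) (by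
    intro u hu v hv
    rw [Submodule.mem_span_pair] at hu hv
    obtain ⟨a, b, rfl⟩ := hu
    obtain ⟨c, d, rfl⟩ := hv
    simp [e1, e2, hsymm y x, ← hQ])
  obtain ⟨v, hv⟩ := finrank_le_one_iff.mp hle
  obtain ⟨a, ha⟩ := hv ⟨x, Submodule.subset_span (by simp)⟩
  obtain ⟨b, hb⟩ := hv ⟨y, Submodule.subset_span (by simp)⟩
  have ha' : a • (v : V) = x := congrArg Subtype.val ha
  have hb' : b • (v : V) = y := congrArg Subtype.val hb
  have hb0 : b ≠ 0 := by rintro rfl; apply hy; rw [← hb']; simp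
  have : ∃ z0, Q x z0 ≠ 0 := by
    by_contra! hc
    exact hx (hnd x hc)
  obtain ⟨z0, hz0⟩ := this
  obtain ⟨z, hz, hzz⟩ : ∃ z, Q x z ≠ 0 ∧ Q z z = 0 := by
    refine ⟨z0 - (Q z0 z0 / (2 * Q x z0)) • x, ?_, ?_⟩
    · simpa [e1] using hz0
    · simp only [map_sub, map_smul, LinearMap.sub_apply, LinearMap.smul_apply, smul_eq_mul, e1]
      rw [hsymm z0 x]
      field_simp
      ring
  have hyz : Q y z ≠ 0 := by
    rw [← hb']
    rw [← ha'] at hz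
    simp only [map_smul, LinearMap.smul_apply, smul_eq_mul] at hz ⊢
    exact mul_ne_zero hb0 (right_ne_zero_of_mul hz)
  obtain ⟨s, hs, ds, hsx⟩ := aux_swap Q hsymm x z (by rw [e1, hzz]) (by
    simp only [map_sub, LinearMap.sub_apply, e1, hzz, hsymm z x]
    intro h
    have : 2 * Q x z = 0 := by linear_combination -h
    exact (mul_ne_zero two hz) this)
  obtain ⟨t, ht, dt, htx⟩ := aux_swap Q hsymm z y (by rw [← hQ, e1, hzz]) (by
    simp only [map_sub, LinearMap.sub_apply, ← hQ, e1, hzz, hsymm z y]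
    intro h
    have : 2 * Q y z = 0 := by linear_combination -h
    exact (mul_ne_zero two hyz) this)
  exact key s t hs ht ds dt (by rw [hsx, htx])
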